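/- For $q \in (0,1]$, let $\Pi_n$ be a Mallows$(n,q)$ random permutation, i.e., $\mathbb{P}(\Pi_n = \pi) = q^{\mathrm{inv}(\pi)} / \sum_{\sigma \in S_n} q^{\mathrm{inv}(\sigma)}$. Let $N := \Pi_n^{-1}(1) - 1$ and $\Pi_N := \mathrm{rk}(\Pi_n(1),\dots,\Pi_n(N))$. Then conditional on $N = m$ (for any $1 \le m < n$), the permutation $\Pi_N$ is distributed as Mallows$(m,q)$. -/

import Mathlib

open MeasureTheory ProbabilityTheory

/-- The number of inversions of a permutation of `Fin n`. -/
def invCount {n : ℕ} (π : Equiv.Perm (Fin n)) : ℕ :=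
  (Finset.univ.filter fun p : Fin n × Fin n => p.1 < p.2 ∧ π p.2 < π p.1).card

/-- The Mallows(n,q) probability of a permutation `π`. -/
noncomputable def mallowsProb (n : ℕ) (q : ℝ) (π : Equiv.Perm (Fin n)) : ℝ :=
  q ^ invCount π / ∑ σ : Equiv.Perm (Fin n), q ^ invCount σ

/-- The (1-based) rank sequence of a finite sequence of distinct numbers. -/
def rkSeq {k : ℕ} (x : Fin k → ℕ) : Fin k → ℕ :=
  fun i => (Finset.univ.filter fun j => x j < x i).card + 1

theorem rkSeq_lt_iff {k : ℕ} (x : Fin k → ℕ) (i j : Fin k) :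
    rkSeq x i < rkSeq x j ↔ x i < x j := by
  unfold rkSeq
  constructor
  · intro h
    by_contra hc
    push Not at hc
    have : (Finset.univ.filter fun l => x l < x j).card ≤
        (Finset.univ.filter fun l => x l < x i).card := by
      apply Finset.card_le_card
      intro l hl
      simp only [Finset.mem_filter, Finset.mem_univ, true_and] at hl ⊢
      omega
    omega
  · intro h
    have : (Finset.univ.filter fun l => x l < x i).card <
        (Finset.univ.filter fun l => x l < x j).card := by
      apply Finset.card_lt_card
      rw [Finset.ssubset_iff_of_subset]
      · exact ⟨i, by simpa using h, by simp⟩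
      · intro l hl
        simp only [Finset.mem_filter, Finset.mem_univ, true_and] at hl ⊢
        omega
    omega

theorem rkSeq_exists {k : ℕ} (x : Fin k → ℕ) (hx : Function.Injective x) :
    ∃ σ : Equiv.Perm (Fin k), ∀ i, rkSeq x i = (σ i : ℕ) + 1 := by
  have hlt : ∀ i, (Finset.univ.filter fun j => x j < x i).card < k := by
    intro i
    have : (Finset.univ.filter fun j => x j < x i).card < (Finset.univ : Finset (Fin k)).card := by
      apply Finset.card_lt_card
      rw [Finset.ssubset_iff_of_subset (Finset.subset_univ _)]
      exact ⟨i, by simp, by simp⟩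
    simpa using this
  let f : Fin k → Fin k := fun i => ⟨_, hlt i⟩
  have hf : Function.Injective f := by
    intro i j hij
    have h1 : rkSeq x i = rkSeq x j := by
      have := congrArg Fin.val hij
      simp only [f] at this
      unfold rkSeq
      omega
    apply hx
    have h2 := rkSeq_lt_iff x i j
    have h3 := rkSeq_lt_iff x j i
    omega
  exact ⟨Equiv.ofBijective f (Finite.injective_iff_bijective.mp hf), fun i => rfl⟩

theorem rkSeq_comp {k : ℕ} (x : Fin k → ℕ) (τ : Equiv.Perm (Fin k)) (i : Fin k) :
    rkSeq (fun j => x (τ j)) i = rkSeq x (τ i) := by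
  unfold rkSeq
  congr 1
  apply Finset.card_bij (fun j _ => τ j)
  · intro a ha; simpa using ha
  · intro a _ b _ h; exact τ.injective h
  · intro b hb
    exact ⟨τ.symm b, by simpa using hb, by simp⟩

/-- inversions whose right position is at least `m` -/
def invRest {n : ℕ} (m : ℕ) (π : Equiv.Perm (Fin n)) : ℕ :=
  (Finset.univ.filter fun p : Fin n × Fin n =>
    (p.1 < p.2 ∧ π p.2 < π p.1) ∧ ¬ (p.2 : ℕ) < m).card

theorem invCount_split {n m : ℕ} (hmn : m ≤ n) (π : Equiv.Perm (Fin n)) (σ : Equiv.Perm (Fin m))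
    (h : ∀ i : Fin m, rkSeq (fun j : Fin m => ((π (Fin.castLE hmn j) : Fin n) : ℕ)) i
      = (σ i : ℕ) + 1) : invCount π = invCount σ + invRest m π := by
  have key : ∀ i j : Fin m, σ i < σ j ↔ π (Fin.castLE hmn i) < π (Fin.castLE hmn j) := by
    intro i j
    have := rkSeq_lt_iff (fun j : Fin m => ((π (Fin.castLE hmn j) : Fin n) : ℕ)) i j
    rw [h i, h j] at this
    rw [Fin.lt_def, Fin.lt_def, ← this]
    omega
  unfold invCount invRest
  rw [← Finset.card_filter_add_card_filter_not (s := Finset.univ.filter fun p : Fin n × Fin n => p.1 < p.2 ∧ π p.2 < π p.1)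
    (fun p => (p.2 : ℕ) < m)]
  rw [Finset.filter_filter, Finset.filter_filter]
  congr 1
  symm
  apply Finset.card_bij (fun p _ => (Fin.castLE hmn p.1, Fin.castLE hmn p.2))
  · rintro ⟨a, b⟩ hab
    simp only [Finset.mem_filter, Finset.mem_univ, true_and] at hab ⊢
    refine ⟨⟨hab.1, (key _ _).1 hab.2⟩, b.2⟩
  · rintro ⟨a, b⟩ _ ⟨c, d⟩ _ hh
    simpa [Prod.ext_iff] using hh
  · rintro ⟨a, b⟩ hab
    simp only [Finset.mem_filter, Finset.mem_univ, true_and] at hab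
    have h1 : (a : ℕ) < b := hab.1.1
    refine ⟨(⟨a, by omega⟩, ⟨b, hab.2⟩), ?_, rfl⟩
    simp only [Finset.mem_filter, Finset.mem_univ, true_and]
    exact ⟨h1, (key _ _).2 hab.1.2⟩

/-- extend a permutation of the first `m` positions -/
noncomputable def extPerm {n m : ℕ} (hmn : m ≤ n) (τ : Equiv.Perm (Fin m)) : Equiv.Perm (Fin n) :=
  τ.viaEmbedding (Fin.castLEEmb hmn)

theorem extPerm_cast {n m : ℕ} (hmn : m ≤ n) (τ : Equiv.Perm (Fin m)) (i : Fin m) :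
    extPerm hmn τ (Fin.castLE hmn i) = Fin.castLE hmn (τ i) :=
  Equiv.Perm.viaEmbedding_apply τ (Fin.castLEEmb hmn) i

theorem extPerm_ge {n m : ℕ} (hmn : m ≤ n) (τ : Equiv.Perm (Fin m)) (i : Fin n)
    (hi : m ≤ (i : ℕ)) : extPerm hmn τ i = i := by
  apply Equiv.Perm.viaEmbedding_apply_of_notMem
  rintro ⟨j, rfl⟩
  have := j.2
  simp at hi
  omega

theorem extPerm_lt {n m : ℕ} (hmn : m ≤ n) (τ : Equiv.Perm (Fin m)) (i : Fin n)
    (hi : (i : ℕ) < m) : (extPerm hmn τ i : ℕ) < m := by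
  have := extPerm_cast hmn τ ⟨i, hi⟩
  have h2 : Fin.castLE hmn ⟨i, hi⟩ = i := rfl
  rw [h2] at this
  rw [this]
  exact (τ ⟨i, hi⟩).2

theorem extPerm_mul_inv {n m : ℕ} (hmn : m ≤ n) (τ : Equiv.Perm (Fin m)) :
    extPerm hmn τ * extPerm hmn τ⁻¹ = 1 := by
  ext i
  by_cases hi : (i : ℕ) < m
  · have h2 : i = Fin.castLE hmn ⟨i, hi⟩ := rfl
    rw [h2, Equiv.Perm.mul_apply, extPerm_cast, extPerm_cast]
    simp
  · push Not at hi
    rw [Equiv.Perm.mul_apply, extPerm_ge _ _ _ hi, extPerm_ge _ _ _ hi]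
    simp

theorem extPerm_lt_iff {n m : ℕ} (hmn : m ≤ n) (τ : Equiv.Perm (Fin m)) (a b : Fin n)
    (hb : ¬ (b : ℕ) < m) : extPerm hmn τ a < b ↔ a < b := by
  by_cases ha : (a : ℕ) < m
  · have := extPerm_lt hmn τ a ha
    rw [Fin.lt_def, Fin.lt_def]
    omega
  · rw [extPerm_ge _ _ _ (by omega)]

theorem invRest_mul {n m : ℕ} (hmn : m ≤ n) (π : Equiv.Perm (Fin n)) (τ : Equiv.Perm (Fin m)) :
    invRest m (π * extPerm hmn τ) = invRest m π := by
  unfold invRest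
  apply Finset.card_bij (fun p _ => (extPerm hmn τ p.1, p.2))
  · rintro ⟨a, b⟩ hab
    simp only [Finset.mem_filter, Finset.mem_univ, true_and] at hab ⊢
    simp only [Equiv.Perm.mul_apply] at hab
    rw [extPerm_ge hmn τ b (by omega)] at hab
    exact ⟨⟨(extPerm_lt_iff hmn τ a b hab.2).2 hab.1.1, hab.1.2⟩, hab.2⟩
  · rintro ⟨a, b⟩ _ ⟨c, d⟩ _ hh
    simpa [Prod.ext_iff] using hh
  · rintro ⟨a, b⟩ hab
    simp only [Finset.mem_filter, Finset.mem_univ, true_and] at hab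
    refine ⟨((extPerm hmn τ).symm a, b), ?_, by simp⟩
    simp only [Finset.mem_filter, Finset.mem_univ, true_and]
    simp only [Equiv.Perm.mul_apply]
    rw [← extPerm_lt_iff hmn τ _ b hab.2, extPerm_ge hmn τ b (by omega)]
    simpa using hab

/-- permutations with minimum at position `m` and prefix pattern `σ` -/
def fiberSet {n m : ℕ} (hmn : m < n) (σ : Equiv.Perm (Fin m)) : Set (Equiv.Perm (Fin n)) :=
  {π | ((π⁻¹ ⟨0, Nat.lt_of_le_of_lt (Nat.zero_le m) hmn⟩ : Fin n) : ℕ) = m ∧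
    ∀ i : Fin m, rkSeq (fun j : Fin m => ((π (Fin.castLE hmn.le j) : Fin n) : ℕ)) i
      = (σ i : ℕ) + 1}

theorem min_pos_iff {n m : ℕ} (hmn : m < n) (π : Equiv.Perm (Fin n)) :
    ((π⁻¹ ⟨0, Nat.lt_of_le_of_lt (Nat.zero_le m) hmn⟩ : Fin n) : ℕ) = m ↔
      π ⟨m, hmn⟩ = ⟨0, Nat.lt_of_le_of_lt (Nat.zero_le m) hmn⟩ := by
  rw [← Equiv.Perm.eq_inv_iff_eq, Fin.ext_iff]
  exact eq_comm

theorem fiberSet_mul {n m : ℕ} (hmn : m < n) (σ τ : Equiv.Perm (Fin m)) (π : Equiv.Perm (Fin n))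
    (h : π ∈ fiberSet hmn σ) : π * extPerm hmn.le τ ∈ fiberSet hmn (σ * τ) := by
  obtain ⟨h1, h2⟩ := h
  refine ⟨?_, ?_⟩
  · rw [min_pos_iff hmn] at h1 ⊢
    rw [Equiv.Perm.mul_apply, extPerm_ge _ _ _ (by simp), h1]
  · intro i
    simp only [Equiv.Perm.mul_apply, extPerm_cast]
    rw [← h2 (τ i)]
    exact rkSeq_comp (fun j : Fin m => ((π (Fin.castLE hmn.le j) : Fin n) : ℕ)) τ i

open Classical in
theorem fiber_sum {n m : ℕ} (hmn : m < n) (q : ℝ) (σ : Equiv.Perm (Fin m)) :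
    ∑ π with π ∈ fiberSet hmn σ, q ^ invCount π =
      q ^ invCount σ * ∑ π with π ∈ fiberSet hmn 1, q ^ invRest m π := by
  rw [Finset.mul_sum]
  apply Finset.sum_bij (fun π _ => π * extPerm hmn.le σ⁻¹)
  · intro π hπ
    simp only [Finset.mem_filter, Finset.mem_univ, true_and] at hπ ⊢
    simpa using fiberSet_mul hmn σ σ⁻¹ π hπ
  · intro a _ b _ hab
    exact mul_right_cancel hab
  · intro π hπ
    simp only [Finset.mem_filter, Finset.mem_univ, true_and] at hπ
    refine ⟨π * extPerm hmn.le σ, ?_, ?_⟩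
    · simp only [Finset.mem_filter, Finset.mem_univ, true_and]
      simpa using fiberSet_mul hmn 1 σ π hπ
    · rw [mul_assoc, extPerm_mul_inv, mul_one]
  · intro π hπ
    simp only [Finset.mem_filter, Finset.mem_univ, true_and] at hπ
    rw [invRest_mul, ← pow_add, invCount_split hmn.le π σ hπ.2]

open Classical in
theorem total_sum {n m : ℕ} (hmn : m < n) (q : ℝ) :
    ∑ π : Equiv.Perm (Fin n) with
      ((π⁻¹ ⟨0, Nat.lt_of_le_of_lt (Nat.zero_le m) hmn⟩ : Fin n) : ℕ) = m, q ^ invCount π =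
      (∑ σ : Equiv.Perm (Fin m), q ^ invCount σ) *
        ∑ π with π ∈ fiberSet hmn 1, q ^ invRest m π := by
  rw [Finset.sum_mul]
  simp_rw [← fiber_sum hmn q]
  rw [← Finset.sum_biUnion]
  · congr 1
    ext π
    simp only [Finset.mem_filter, Finset.mem_univ, true_and, Finset.mem_biUnion]
    constructor
    · intro h
      obtain ⟨σ, hσ⟩ := rkSeq_exists (fun j : Fin m => ((π (Fin.castLE hmn.le j) : Fin n) : ℕ))
        (by
          intro a b hab
          have h3 := π.injective (Fin.ext hab)
          simpa using h3)
      exact ⟨σ, h, hσ⟩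
    · rintro ⟨σ, h, _⟩
      exact h
  · intro σ _ τ _ hne
    rw [Function.onFun, Finset.disjoint_left]
    intro π h1 h2
    simp only [Finset.mem_filter, Finset.mem_univ, true_and] at h1 h2
    apply hne
    ext i
    have a1 := h1.2 i
    have a2 := h2.2 i
    omega

theorem nullMeas_of_compl {Ω : Type*} [MeasurableSpace Ω] (μ : Measure Ω) [IsProbabilityMeasure μ]
    (A : Set Ω) (h : μ A + μ Aᶜ ≤ 1) : NullMeasurableSet A μ := by
  have hC : MeasurableSet (toMeasurable μ Aᶜ) := measurableSet_toMeasurable _ _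
  have hsub : (toMeasurable μ Aᶜ)ᶜ ⊆ A := by
    rw [Set.compl_subset_comm]
    exact subset_toMeasurable _ _
  have hle : μ (toMeasurable μ A) ≤ μ (toMeasurable μ Aᶜ)ᶜ := by
    rw [prob_compl_eq_one_sub hC, measure_toMeasurable, measure_toMeasurable]
    exact ENNReal.le_sub_of_add_le_right (measure_ne_top _ _) h
  have hae : (toMeasurable μ Aᶜ)ᶜ =ᵐ[μ] toMeasurable μ A :=
    ae_eq_of_subset_of_measure_ge (hsub.trans (subset_toMeasurable _ _)) hle
      hC.compl.nullMeasurableSet (measure_ne_top _ _)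
  have : (toMeasurable μ Aᶜ)ᶜ =ᵐ[μ] A := by
    refine Filter.EventuallyLE.antisymm hsub.eventuallyLE ?_
    exact (subset_toMeasurable μ A).eventuallyLE.trans hae.symm.le
  exact hC.compl.nullMeasurableSet.congr this

open Classical in
theorem law_set {Ω : Type*} [MeasurableSpace Ω] (μ : Measure Ω) [IsProbabilityMeasure μ]
    (n : ℕ) (q : ℝ) (hq0 : 0 < q) (Pi : Ω → Equiv.Perm (Fin n))
    (hlaw : ∀ π : Equiv.Perm (Fin n),
      μ {ω | Pi ω = π} = ENNReal.ofReal (mallowsProb n q π)) (S : Set (Equiv.Perm (Fin n))) :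
    NullMeasurableSet {ω | Pi ω ∈ S} μ ∧
    μ {ω | Pi ω ∈ S} = ENNReal.ofReal
      ((∑ π with π ∈ S, q ^ invCount π) / ∑ σ : Equiv.Perm (Fin n), q ^ invCount σ) := by
  have hZ : 0 < ∑ σ : Equiv.Perm (Fin n), q ^ invCount σ :=
    Finset.sum_pos (fun _ _ => by positivity) Finset.univ_nonempty
  have hle : ∀ T : Set (Equiv.Perm (Fin n)), μ {ω | Pi ω ∈ T} ≤ ENNReal.ofReal
      ((∑ π with π ∈ T, q ^ invCount π) / ∑ σ : Equiv.Perm (Fin n), q ^ invCount σ) := by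
    intro T
    rw [Finset.sum_div, ENNReal.ofReal_sum_of_nonneg (fun _ _ => by positivity)]
    calc μ {ω | Pi ω ∈ T} ≤ μ (⋃ π ∈ Finset.univ.filter (· ∈ T), {ω | Pi ω = π}) := by
          apply measure_mono
          intro ω hω
          simpa using hω
      _ ≤ ∑ π with π ∈ T, μ {ω | Pi ω = π} := measure_biUnion_finset_le _ _
      _ = _ := Finset.sum_congr rfl (fun π _ => hlaw π)
  have h1 := hle S
  have h2 : μ {ω | Pi ω ∈ Sᶜ} ≤ ENNReal.ofReal
      ((∑ π with π ∈ Sᶜ, q ^ invCount π) / ∑ σ : Equiv.Perm (Fin n), q ^ invCount σ) := by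
    convert hle Sᶜ
  have hcompl : {ω | Pi ω ∈ Sᶜ} = {ω | Pi ω ∈ S}ᶜ := rfl
  have hsum : ENNReal.ofReal
      ((∑ π with π ∈ S, q ^ invCount π) / ∑ σ : Equiv.Perm (Fin n), q ^ invCount σ) +
      ENNReal.ofReal
      ((∑ π with π ∈ Sᶜ, q ^ invCount π) / ∑ σ : Equiv.Perm (Fin n), q ^ invCount σ) = 1 := by
    rw [← ENNReal.ofReal_add (by positivity) (by positivity), ← add_div]
    have : (∑ π with π ∈ S, q ^ invCount π) + (∑ π with π ∈ Sᶜ, q ^ invCount π) =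
        ∑ σ : Equiv.Perm (Fin n), q ^ invCount σ := by
      simp only [Set.mem_compl_iff]
      exact Finset.sum_filter_add_sum_filter_not _ _ _
    rw [this, div_self hZ.ne', ENNReal.ofReal_one]
  rw [hcompl] at h2
  refine ⟨nullMeas_of_compl μ _ ((add_le_add h1 h2).trans hsum.le), le_antisymm h1 ?_⟩
  have h3 : (1 : ENNReal) ≤ μ {ω | Pi ω ∈ S} + μ {ω | Pi ω ∈ S}ᶜ := by
    rw [← measure_univ (μ := μ), ← Set.union_compl_self {ω | Pi ω ∈ S}]
    exact measure_union_le _ _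
  rw [← hsum] at h3
  exact (ENNReal.add_le_add_iff_right ENNReal.ofReal_ne_top).1 (h3.trans (add_le_add le_rfl h2))

/-- Let `Πₙ ~ Mallows(n,q)` with `0 < q ≤ 1`, let `N = Πₙ⁻¹(1) - 1` (the number of positions
before the position of the minimal value), and `Π_N = rk(Πₙ(1), …, Πₙ(N))`. Then,
conditionally on `N = m` (for `1 ≤ m < n`), `Π_N` is distributed as Mallows(m,q). -/
theorem mallows_prefix_before_min_cond
    {Ω : Type*} [MeasurableSpace Ω] (μ : Measure Ω) [IsProbabilityMeasure μ]
    (n : ℕ) (q : ℝ) (hq0 : 0 < q) (hq1 : q ≤ 1)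
    (Pi : Ω → Equiv.Perm (Fin n))
    (hlaw : ∀ π : Equiv.Perm (Fin n),
      μ {ω | Pi ω = π} = ENNReal.ofReal (mallowsProb n q π))
    (m : ℕ) (hm : 1 ≤ m) (hmn : m < n)
    (hpos : μ {ω | (((Pi ω)⁻¹ ⟨0, Nat.lt_of_le_of_lt (Nat.zero_le m) hmn⟩ : Fin n) : ℕ) = m} ≠ 0)
    (σ : Equiv.Perm (Fin m)) :
    μ[|{ω | (((Pi ω)⁻¹ ⟨0, Nat.lt_of_le_of_lt (Nat.zero_le m) hmn⟩ : Fin n) : ℕ) = m}]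
        {ω | ∀ i : Fin m,
          rkSeq (fun j : Fin m => ((Pi ω (Fin.castLE hmn.le j) : Fin n) : ℕ)) i
            = (σ i : ℕ) + 1}
      = ENNReal.ofReal (mallowsProb m q σ) := by
  classical
  obtain ⟨hA, hAm⟩ := law_set μ n q hq0 Pi hlaw
    {π | ((π⁻¹ ⟨0, Nat.lt_of_le_of_lt (Nat.zero_le m) hmn⟩ : Fin n) : ℕ) = m}
  obtain ⟨-, hFm⟩ := law_set μ n q hq0 Pi hlaw (fiberSet hmn σ)
  simp only [Set.mem_setOf_eq] at hA hAm
  rw [total_sum hmn q] at hAm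
  rw [fiber_sum hmn q σ] at hFm
  rw [ProbabilityTheory.cond, Measure.smul_apply, Measure.restrict_apply₀' hA, smul_eq_mul]
  rw [hAm] at hpos
  have hset : {ω | ∀ i : Fin m,
          rkSeq (fun j : Fin m => ((Pi ω (Fin.castLE hmn.le j) : Fin n) : ℕ)) i
            = (σ i : ℕ) + 1} ∩ {ω | (((Pi ω)⁻¹ ⟨0, Nat.lt_of_le_of_lt (Nat.zero_le m) hmn⟩ : Fin n) : ℕ) = m}
      = {ω | Pi ω ∈ fiberSet hmn σ} := by
    ext ω
    exact and_comm
  rw [hset, hAm, hFm]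
  have hp := ENNReal.ofReal_pos.1 (pos_iff_ne_zero.2 hpos)
  rw [← ENNReal.ofReal_inv_of_pos hp, ← ENNReal.ofReal_mul (inv_nonneg.2 hp.le)]
  congr 1
  unfold mallowsProb
  generalize (∑ π with π ∈ fiberSet hmn 1, q ^ invRest m π) = K at *
  generalize (∑ σ : Equiv.Perm (Fin n), q ^ invCount σ) = Z at *
  generalize (∑ σ : Equiv.Perm (Fin m), q ^ invCount σ) = Y at *
  have hZ : Z ≠ 0 := by rintro rfl; simp at hp
  have hK : K ≠ 0 := by rintro rfl; simp at hp
  have hY : Y ≠ 0 := by rintro rfl; simp at hp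
  field_simp
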